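/- arXiv:1907.08048 — 7 statements merged into one kernel-verified Lean document; each statement's English description precedes it below -/
import Mathlib

section
/- Let x ∈ ℝⁿ satisfy x_1 ≤ x_2 ≤ … ≤ x_n, and for each i let C_i = {k : x_k ≥ x_i}. Then the Lovász extension of the cut function evaluated at x equals the graph total variation of x: ∑_{i=1}^{n−1} K(C_{i+1})(x_{i+1} − x_i) + K(V)·x_1 = (1/2) ∑_{i=1}^n ∑_{j=1}^n A_{ij} |x_i − x_j|. -/
/-- The jumps of a nondecreasing sequence that separate the level of `b` from that of `a` add up
to the positive part of `x a - x b`. -/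
lemma sum_separating_jumps {n : ℕ} {x : ℕ → ℝ}
    (hx : ∀ i j, i < n → j < n → i ≤ j → x i ≤ x j) {a b : ℕ} (ha : a < n) (hb : b < n) :
    ∑ t ∈ Finset.range (n - 1),
      (if x (t + 1) ≤ x a ∧ x b < x (t + 1) then x (t + 1) - x t else 0)
      = max (x a - x b) 0 := by
  have hstep : ∀ t ∈ Finset.range (n - 1),
      (if x (t + 1) ≤ x a ∧ x b < x (t + 1) then x (t + 1) - x t else 0)
      = max (min (x (t + 1)) (x a)) (x b) - max (min (x t) (x a)) (x b) := by
    intro t ht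
    rw [Finset.mem_range] at ht
    have hmono := hx t (t + 1) (by lia) (by lia) (by lia)
    have hcmp : ∀ c, c < n → x (t + 1) ≤ x c ∨ x c ≤ x t := fun c hc =>
      (le_or_gt (t + 1) c).imp (hx (t + 1) c (by lia) hc) fun h =>
        hx c t hc (by lia) (by lia)
    have hca := hcmp a ha
    have hcb := hcmp b hb
    grind
  rw [Finset.sum_congr rfl hstep,
    Finset.sum_range_sub fun t => max (min (x t) (x a)) (x b),
    min_eq_right (hx a (n - 1) ha (by lia) (by lia)),
    max_eq_right ((min_le_left _ _).trans (hx 0 b (by lia) hb (by lia)))]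
  rcases le_total (x a) (x b) with h | h <;> simp [h]

/-- Symmetric weights give the positive parts of differences half the total variation. -/
lemma sum_mul_posPart_sub_eq {ι : Type*} (s : Finset ι) {A : ι → ι → ℝ}
    (hsym : ∀ i j, A i j = A j i) (x : ι → ℝ) :
    ∑ i ∈ s, ∑ j ∈ s, A i j * max (x i - x j) 0
      = (1 / 2) * ∑ i ∈ s, ∑ j ∈ s, A i j * |x i - x j| := by
  have hswap : ∑ i ∈ s, ∑ j ∈ s, A i j * max (x i - x j) 0
      = ∑ i ∈ s, ∑ j ∈ s, A i j * max (x j - x i) 0 := by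
    rw [Finset.sum_comm]
    simp only [hsym]
  have habs : ∑ i ∈ s, ∑ j ∈ s, A i j * |x i - x j|
      = ∑ i ∈ s, ∑ j ∈ s, A i j * max (x i - x j) 0
        + ∑ i ∈ s, ∑ j ∈ s, A i j * max (x j - x i) 0 := by
    simp only [← Finset.sum_add_distrib, ← mul_add]
    refine Finset.sum_congr rfl fun i _ => Finset.sum_congr rfl fun j _ => ?_
    congr 1
    grind
  linarith

/-- Let `x ∈ ℝⁿ` satisfy `x_1 ≤ x_2 ≤ … ≤ x_n` and, for each `i`, let
`C_i = {k : x_k ≥ x_i}`. Then the Lovász extension of the cut function evaluated at `x`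
equals the graph total variation of `x`:
`∑_{i=1}^{n−1} K(C_{i+1})(x_{i+1} − x_i) + K(V)·x_1 = (1/2) ∑_{i,j} A_{ij} |x_i − x_j|`.
(Nodes are indexed `0,…,n-1` here.) -/
theorem lovasz_cut_eq_tv (n : ℕ) (hn : 0 < n) (A : ℕ → ℕ → ℝ)
    (hsym : ∀ i j, A i j = A j i) (hnn : ∀ i j, 0 ≤ A i j)
    (x : ℕ → ℝ) (hx : ∀ i j, i < n → j < n → i ≤ j → x i ≤ x j)
    (K : Finset ℕ → ℝ)
    (hK : ∀ S : Finset ℕ, K S = ∑ i ∈ S, ∑ j ∈ (Finset.range n) \ S, A i j)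
    (C : ℕ → Finset ℕ)
    (hC : ∀ i, C i = (Finset.range n).filter (fun k => x i ≤ x k)) :
    (∑ i ∈ Finset.range (n - 1), K (C (i + 1)) * (x (i + 1) - x i))
      + K (Finset.range n) * x 0
    = (1 / 2) * ∑ i ∈ Finset.range n, ∑ j ∈ Finset.range n, A i j * |x i - x j| := by
  have hlevel : ∀ t, K (C (t + 1)) * (x (t + 1) - x t)
      = ∑ a ∈ Finset.range n, ∑ b ∈ Finset.range n, A a b *
          (if x (t + 1) ≤ x a ∧ x b < x (t + 1) then x (t + 1) - x t else 0) := by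
    intro t
    rw [hK, hC, ← Finset.filter_not, Finset.sum_filter, Finset.sum_mul]
    refine Finset.sum_congr rfl fun a _ => ?_
    split_ifs with h
    · rw [Finset.sum_filter, Finset.sum_mul]
      refine Finset.sum_congr rfl fun b _ => ?_
      simp [h]
    · simp [h]
  have hV : K (Finset.range n) = 0 := by simp [hK]
  rw [hV, zero_mul, add_zero, Finset.sum_congr rfl fun t _ => hlevel t, Finset.sum_comm,
    ← sum_mul_posPart_sub_eq _ hsym]
  refine Finset.sum_congr rfl fun a ha => ?_
  rw [Finset.sum_comm]
  refine Finset.sum_congr rfl fun b hb => ?_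
  rw [← Finset.mul_sum,
    sum_separating_jumps hx (Finset.mem_range.mp ha) (Finset.mem_range.mp hb)]
end

section
/- Let x ∈ ℝⁿ satisfy x_1 ≤ x_2 ≤ … ≤ x_n, and for each i let C_i = {k : x_k ≥ x_i}. Then the Lovász extension of the modularity function evaluated at x satisfies ∑_{i=1}^{n−1} Q(C_{i+1})(x_{i+1} − x_i) + Q(V)·x_1 = (1/(2·vol G)) ∑_{i=1}^n ∑_{j=1}^n (d_i d_j / vol G − A_{ij}) |x_i − x_j|. -/
open Finset in
/-- For a sequence that is monotone on `0, …, n - 1`, the increments up to level `x a` add up to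
`x a - x 0`. -/
theorem sum_increments_below_level {n : ℕ} {x : ℕ → ℝ}
    (hx : ∀ i j, i < n → j < n → i ≤ j → x i ≤ x j) {a : ℕ} (ha : a < n) :
    ∑ i ∈ range (n - 1), (if x (i + 1) ≤ x a then x (i + 1) - x i else 0) = x a - x 0 := by
  have hterm : ∀ i ∈ range (n - 1), (if x (i + 1) ≤ x a then x (i + 1) - x i else 0)
      = min (x (i + 1)) (x a) - min (x i) (x a) := by
    intro i hi
    have hi' : i + 1 < n := by have := mem_range.mp hi; omega
    split_ifs with h
    · rw [min_eq_left h, min_eq_left ((hx i (i + 1) (by omega) hi' (by omega)).trans h)]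
    · have hai : a ≤ i := by
        by_contra hlt
        exact h (hx _ _ hi' ha (by omega))
      rw [min_eq_right (not_le.mp h).le, min_eq_right (hx a i ha (by omega) hai), sub_self]
  rw [sum_congr rfl hterm, sum_range_sub (fun i => min (x i) (x a)),
    min_eq_right (hx a (n - 1) ha (by omega) (by omega)),
    min_eq_left (hx 0 a (by omega) ha (by omega))]

open Finset in
/-- Layer-cake formula: weighting the upper level sets of a monotone sequence by its increments
turns the quadratic set function of `M` into a sum of minima. -/
theorem sum_superlevel_mul_increment {n : ℕ} {x : ℕ → ℝ}
    (hx : ∀ i j, i < n → j < n → i ≤ j → x i ≤ x j) (M : ℕ → ℕ → ℝ) :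
    ∑ i ∈ range (n - 1), (∑ a ∈ (range n).filter (fun k => x (i + 1) ≤ x k),
        ∑ b ∈ (range n).filter (fun k => x (i + 1) ≤ x k), M a b) * (x (i + 1) - x i)
      = ∑ a ∈ range n, ∑ b ∈ range n, M a b * (min (x a) (x b) - x 0) := by
  have hlevel : ∀ a ∈ range n, ∀ b ∈ range n, M a b * (min (x a) (x b) - x 0)
      = ∑ i ∈ range (n - 1),
        M a b * (if x (i + 1) ≤ min (x a) (x b) then x (i + 1) - x i else 0) := by
    intro a ha b hb
    rw [← mul_sum]
    rcases min_choice (x a) (x b) with h | h <;> rw [h]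
    · rw [sum_increments_below_level hx (mem_range.mp ha)]
    · rw [sum_increments_below_level hx (mem_range.mp hb)]
  rw [sum_congr rfl fun a ha => (sum_congr rfl (hlevel a ha)).trans sum_comm, sum_comm]
  refine sum_congr rfl fun i _ => ?_
  rw [sum_filter, sum_mul]
  refine sum_congr rfl fun a _ => ?_
  rw [sum_filter]
  by_cases h : x (i + 1) ≤ x a
  · simp only [h, if_true, le_min_iff, true_and, sum_mul]
    refine sum_congr rfl fun b _ => ?_
    split_ifs <;> simp
  · simp [h]

open Finset in
/-- A symmetric kernel with vanishing row sums pairs with minima as it does with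
`-|x a - x b| / 2`. -/
theorem sum_mul_min_of_row_sum_eq_zero {s : Finset ℕ} {M : ℕ → ℕ → ℝ}
    (hsymm : ∀ a b, M a b = M b a) (hrow : ∀ a, ∑ b ∈ s, M a b = 0) (x : ℕ → ℝ) (c : ℝ) :
    ∑ a ∈ s, ∑ b ∈ s, M a b * (min (x a) (x b) - c)
      = 1 / 2 * ∑ a ∈ s, ∑ b ∈ s, -M a b * |x a - x b| := by
  have hleft : ∑ a ∈ s, ∑ b ∈ s, M a b * (x a / 2 - c) = 0 :=
    sum_eq_zero fun a _ => by rw [← sum_mul, hrow, zero_mul]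
  have hright : ∑ a ∈ s, ∑ b ∈ s, M a b * (x b / 2) = 0 := by
    rw [sum_comm]
    refine sum_eq_zero fun b _ => ?_
    rw [← sum_mul, sum_congr rfl fun a _ => hsymm a b, hrow, zero_mul]
  rw [← add_zero (1 / 2 * _), ← hleft, ← add_zero (_ + _), ← hright]
  simp only [mul_sum, ← sum_add_distrib]
  refine sum_congr rfl fun a _ => sum_congr rfl fun b _ => ?_
  rcases le_total (x a) (x b) with h | h
  · rw [min_eq_left h, abs_of_nonpos (sub_nonpos.mpr h)]
    ring
  · rw [min_eq_right h, abs_of_nonneg (sub_nonneg.mpr h)]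
    ring

/-- Let `x ∈ ℝⁿ` satisfy `x_1 ≤ x_2 ≤ … ≤ x_n` and, for each `i`, let
`C_i = {k : x_k ≥ x_i}`. Then the Lovász extension of the modularity function evaluated
at `x` satisfies
`∑_{i=1}^{n−1} Q(C_{i+1})(x_{i+1} − x_i) + Q(V)·x_1
  = (1/(2·vol G)) ∑_{i,j} (d_i d_j / vol G − A_{ij}) |x_i − x_j|`.
(Nodes are indexed `0,…,n-1` here.) -/
theorem lovasz_modularity_eq_tvQ (n : ℕ) (hn : 0 < n) (A : ℕ → ℕ → ℝ)
    (hsym : ∀ i j, A i j = A j i) (hnn : ∀ i j, 0 ≤ A i j)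
    (d : ℕ → ℝ) (hd : ∀ i, d i = ∑ j ∈ Finset.range n, A i j)
    (vol : ℝ) (hvol : vol = ∑ i ∈ Finset.range n, d i) (hvolpos : 0 < vol)
    (Q : Finset ℕ → ℝ)
    (hQ : ∀ S : Finset ℕ,
      Q S = (1 / vol) * ∑ i ∈ S, ∑ j ∈ S, (A i j - d i * d j / vol))
    (x : ℕ → ℝ) (hx : ∀ i j, i < n → j < n → i ≤ j → x i ≤ x j)
    (C : ℕ → Finset ℕ)
    (hC : ∀ i, C i = (Finset.range n).filter (fun k => x i ≤ x k)) :
    (∑ i ∈ Finset.range (n - 1), Q (C (i + 1)) * (x (i + 1) - x i))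
      + Q (Finset.range n) * x 0
    = (1 / (2 * vol)) * ∑ i ∈ Finset.range n, ∑ j ∈ Finset.range n,
        (d i * d j / vol - A i j) * |x i - x j| := by
  have hrow : ∀ a, ∑ b ∈ Finset.range n, (A a b - d a * d b / vol) = 0 := by
    intro a
    rw [Finset.sum_sub_distrib, ← hd, ← Finset.sum_div, ← Finset.mul_sum, ← hvol,
      mul_div_cancel_right₀ _ hvolpos.ne', sub_self]
  have hsymm : ∀ a b, A a b - d a * d b / vol = A b a - d b * d a / vol := by
    intro a b
    rw [hsym, mul_comm (d a)]
  have hQV : Q (Finset.range n) = 0 := by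
    rw [hQ, Finset.sum_eq_zero fun a _ => hrow a, mul_zero]
  have hmin := (sum_superlevel_mul_increment hx fun a b => A a b - d a * d b / vol).trans
    (sum_mul_min_of_row_sum_eq_zero hsymm hrow x (x 0))
  simp only [neg_sub] at hmin
  simp only [hQV, zero_mul, add_zero, hQ, hC, mul_assoc, ← Finset.mul_sum]
  rw [hmin, ← mul_assoc]
  congr 1
  field_simp
end

section
/- Let S ⊆ V and a, b ∈ ℝ, and let x ∈ ℝⁿ be the vector with x_i = a for i ∈ S and x_i = b for i ∉ S. Then TV_Q(x) = vol G · |a − b| · Q(S). -/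
/-- For a symmetric kernel with vanishing row sums, the total variation form evaluated at a vector
taking the value `a` on `S` and `b` off `S` is determined by the sum of the kernel over `S × S`. -/
theorem sum_mul_abs_sub_ite {ι : Type*} [Fintype ι] [DecidableEq ι] (B : ι → ι → ℝ)
    (hsym : ∀ i j, B i j = B j i) (hrow : ∀ i, ∑ j, B i j = 0) (S : Finset ι) (a b : ℝ) :
    ∑ i, ∑ j, B i j * |(if i ∈ S then a else b) - (if j ∈ S then a else b)| =
      -2 * |a - b| * ∑ i ∈ S, ∑ j ∈ S, B i j := by
  let χ : ι → ℝ := fun i => if i ∈ S then 1 else 0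
  have habs : ∀ i j, |(if i ∈ S then a else b) - (if j ∈ S then a else b)| =
      |a - b| * (χ i + χ j - 2 * (χ i * χ j)) := by
    intro i j
    by_cases hi : i ∈ S <;> by_cases hj : j ∈ S <;> simp [χ, hi, hj, abs_sub_comm b a]
    norm_num
  have hleft : ∑ i, ∑ j, χ i * B i j = 0 := by
    simp [← Finset.mul_sum, hrow]
  have hright : ∑ i, ∑ j, χ j * B i j = 0 := by
    rw [Finset.sum_comm, ← hleft]
    exact Finset.sum_congr rfl fun i _ => Finset.sum_congr rfl fun j _ => by rw [hsym j i]
  have hS : ∑ i, ∑ j, χ i * (χ j * B i j) = ∑ i ∈ S, ∑ j ∈ S, B i j := by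
    simp [χ, Finset.sum_ite_mem]
  calc
    _ = |a - b| * (∑ i, ∑ j, χ i * B i j + ∑ i, ∑ j, χ j * B i j
          - 2 * ∑ i, ∑ j, χ i * (χ j * B i j)) := by
      simp only [Finset.mul_sum, ← Finset.sum_add_distrib, ← Finset.sum_sub_distrib]
      refine Finset.sum_congr rfl fun i _ => Finset.sum_congr rfl fun j _ => ?_
      rw [habs]
      ring
    _ = _ := by
      rw [hleft, hright, hS]
      ring

/-- Let `S ⊆ V` and `a, b ∈ ℝ`, and let `x ∈ ℝⁿ` be the vector with
`x_i = a` for `i ∈ S` and `x_i = b` for `i ∉ S`. Then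
`TV_Q(x) = vol G · |a − b| · Q(S)`. -/
theorem tvQ_two_valued (n : ℕ) (A : Fin n → Fin n → ℝ)
    (hsym : ∀ i j, A i j = A j i) (hnn : ∀ i j, 0 ≤ A i j)
    (d : Fin n → ℝ) (hd : ∀ i, d i = ∑ j, A i j)
    (vol : ℝ) (hvol : vol = ∑ i, d i) (hvolpos : 0 < vol)
    (Q : Finset (Fin n) → ℝ)
    (hQ : ∀ S : Finset (Fin n),
      Q S = (1 / vol) * ∑ i ∈ S, ∑ j ∈ S, (A i j - d i * d j / vol))
    (TVQ : (Fin n → ℝ) → ℝ)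
    (hTVQ : ∀ y : Fin n → ℝ,
      TVQ y = (1 / 2) * ∑ i, ∑ j, (d i * d j / vol - A i j) * |y i - y j|)
    (S : Finset (Fin n)) (a b : ℝ) (x : Fin n → ℝ)
    (hx : ∀ i, x i = if i ∈ S then a else b) :
    TVQ x = vol * |a - b| * Q S := by
  have hB := sum_mul_abs_sub_ite (fun i j => A i j - d i * d j / vol)
    (fun i j => by rw [hsym i j, mul_comm (d i)])
    (fun i => by
      rw [Finset.sum_sub_distrib, ← hd, ← Finset.sum_div, ← Finset.mul_sum, ← hvol,
        mul_div_cancel_right₀ _ hvolpos.ne', sub_self]) S a b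
  have hneg : ∑ i, ∑ j, (d i * d j / vol - A i j) * |x i - x j| =
      -∑ i, ∑ j, (A i j - d i * d j / vol) *
        |(if i ∈ S then a else b) - (if j ∈ S then a else b)| := by
    simp only [← Finset.sum_neg_distrib, ← neg_mul, neg_sub, hx]
  rw [hTVQ, hneg, hB, hQ]
  generalize ∑ i ∈ S, ∑ j ∈ S, (A i j - d i * d j / vol) = q
  field_simp
end

section
/- Let a, b > 0 and let B(a,b) = {x ∈ ℝⁿ : −a ≤ x_i ≤ b for all i}. Then the maximum of the modularity total variation over the box equals vol G · (a+b) times the maximum modularity over all subsets: max_{x ∈ B(a,b)} TV_Q(x) = vol G · (a + b) · max_{S ⊆ V} Q(S). In particular, if x* maximizes TV_Q over B(a,b), then TV_Q(x*) = vol G · (a + b) · max_{S ⊆ V} Q(S). -/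
open MeasureTheory in
/-- Layer-cake bound: a weighted total variation on a box `[l, u]` is at most `u - l` times a
bound for its values on indicator functions. -/
theorem sum_mul_abs_sub_le_of_indicator {ι : Type*} [Fintype ι] (c : ι → ι → ℝ) (M l u : ℝ)
    (hlu : l ≤ u)
    (hM : ∀ S : Finset ι, ∑ i, ∑ j, c i j *
      |(S : Set ι).indicator 1 i - (S : Set ι).indicator (1 : ι → ℝ) j| ≤ M)
    (x : ι → ℝ) (hx : ∀ i, l ≤ x i ∧ x i ≤ u) :
    ∑ i, ∑ j, c i j * |x i - x j| ≤ (u - l) * M := by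
  have hint : ∀ p q : ℝ, Integrable ((Set.Ico p q).indicator (1 : ℝ → ℝ)) := fun p q =>
    (integrable_indicator_iff measurableSet_Ico).2
      (integrableOn_const (by simp) (by simp))
  have hval : ∀ p q : ℝ, p ≤ q → ∫ t, (Set.Ico p q).indicator (1 : ℝ → ℝ) t = q - p := by
    intro p q hpq
    rw [integral_indicator_one measurableSet_Ico, Real.volume_real_Ico_of_le hpq]
  have hpt : ∀ t : ℝ,
      ∑ i, ∑ j, c i j * (Set.Ico (min (x i) (x j)) (max (x i) (x j))).indicator (1 : ℝ → ℝ) t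
        ≤ (Set.Ico l u).indicator (1 : ℝ → ℝ) t * M := by
    intro t
    by_cases ht : t ∈ Set.Ico l u
    · rw [Set.indicator_of_mem ht, Pi.one_apply, one_mul]
      refine le_of_eq_of_le ?_ (hM {i | t < x i})
      refine Finset.sum_congr rfl fun i _ => Finset.sum_congr rfl fun j _ => ?_
      congr 1
      by_cases hi : t < x i <;> by_cases hj : t < x j <;>
        simp [hi, hj, not_le.2, not_lt.1]
    · rw [Set.indicator_of_notMem ht, zero_mul]
      refine (Finset.sum_eq_zero fun i _ => Finset.sum_eq_zero fun j _ => ?_).le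
      rw [Set.indicator_of_notMem, mul_zero]
      exact fun h => ht ⟨(le_min (hx i).1 (hx j).1).trans h.1,
        h.2.trans_le (max_le (hx i).2 (hx j).2)⟩
  have key := integral_mono
    (integrable_finsetSum _ fun i _ => integrable_finsetSum _ fun j _ =>
      (hint (min (x i) (x j)) (max (x i) (x j))).const_mul (c i j))
    ((hint l u).mul_const M) hpt
  rw [integral_mul_const, hval l u hlu, integral_finsetSum _ fun i _ =>
    integrable_finsetSum _ fun j _ => (hint _ _).const_mul _] at key
  refine le_of_eq_of_le (Finset.sum_congr rfl fun i _ => ?_) key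
  rw [integral_finsetSum _ fun j _ => (hint _ _).const_mul _]
  refine Finset.sum_congr rfl fun j _ => ?_
  rw [integral_const_mul, hval _ _ min_le_max, max_sub_min_eq_abs']

/-- For weights with vanishing row and column sums, the total variation of an indicator function
is `-2` times the weight inside the set. -/
theorem sum_mul_abs_indicator_sub {ι : Type*} [Fintype ι] (c : ι → ι → ℝ)
    (hrow : ∀ i, ∑ j, c i j = 0) (hcol : ∀ j, ∑ i, c i j = 0) (S : Finset ι) :
    ∑ i, ∑ j, c i j * |(S : Set ι).indicator 1 i - (S : Set ι).indicator (1 : ι → ℝ) j| =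
      -2 * ∑ i ∈ S, ∑ j ∈ S, c i j := by
  classical
  set f : ι → ℝ := (S : Set ι).indicator 1 with hf
  have habs : ∀ i j, c i j * |f i - f j| =
      f i * c i j + f j * c i j - 2 * (f i * (f j * c i j)) := by
    intro i j
    by_cases hi : i ∈ S <;> by_cases hj : j ∈ S <;> simp [hf, hi, hj]; ring
  have h1 : ∑ i, ∑ j, f i * c i j = 0 := by simp [← Finset.mul_sum, hrow]
  have h2 : ∑ i, ∑ j, f j * c i j = 0 := by
    rw [Finset.sum_comm]; simp [← Finset.mul_sum, hcol]
  have h3 : ∑ i, ∑ j, f i * (f j * c i j) = ∑ i ∈ S, ∑ j ∈ S, c i j := by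
    simp [hf, Set.indicator_apply, Finset.sum_ite_mem]
  simp only [habs, Finset.sum_add_distrib, Finset.sum_sub_distrib, ← Finset.mul_sum] at *
  rw [h1, h2, h3]
  ring

/-- Let `a, b > 0` and `B(a,b) = {x ∈ ℝⁿ : −a ≤ x_i ≤ b ∀ i}`. Then the
maximum of the modularity total variation over the box equals `vol G · (a+b)` times the
maximum modularity over all subsets. In particular, if `x*` maximizes `TV_Q` over
`B(a,b)` and `S*` maximizes `Q` over subsets of `V`, then
`TV_Q(x*) = vol G · (a + b) · Q(S*)`. -/
theorem tvQ_box_max_eq_modularity_max (n : ℕ) (A : Fin n → Fin n → ℝ)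
    (hsym : ∀ i j, A i j = A j i) (hnn : ∀ i j, 0 ≤ A i j)
    (d : Fin n → ℝ) (hd : ∀ i, d i = ∑ j, A i j)
    (vol : ℝ) (hvol : vol = ∑ i, d i) (hvolpos : 0 < vol)
    (Q : Finset (Fin n) → ℝ)
    (hQ : ∀ S : Finset (Fin n),
      Q S = (1 / vol) * ∑ i ∈ S, ∑ j ∈ S, (A i j - d i * d j / vol))
    (TVQ : (Fin n → ℝ) → ℝ)
    (hTVQ : ∀ y : Fin n → ℝ,
      TVQ y = (1 / 2) * ∑ i, ∑ j, (d i * d j / vol - A i j) * |y i - y j|)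
    (a b : ℝ) (ha : 0 < a) (hb : 0 < b)
    (xstar : Fin n → ℝ)
    (hxstar_feas : ∀ i, -a ≤ xstar i ∧ xstar i ≤ b)
    (hxstar_max : ∀ x : Fin n → ℝ, (∀ i, -a ≤ x i ∧ x i ≤ b) → TVQ x ≤ TVQ xstar)
    (Sstar : Finset (Fin n))
    (hSstar_max : ∀ S : Finset (Fin n), Q S ≤ Q Sstar) :
    TVQ xstar = vol * (a + b) * Q Sstar := by
  set c : Fin n → Fin n → ℝ := fun i j => d i * d j / vol - A i j with hc
  have hrow : ∀ i, ∑ j, c i j = 0 := by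
    intro i
    rw [hc, Finset.sum_sub_distrib, ← Finset.sum_div, ← Finset.mul_sum, ← hvol, ← hd,
      mul_div_cancel_right₀ _ hvolpos.ne', sub_self]
  have hcsymm : ∀ i j, c i j = c j i := fun i j => by simp only [hc, hsym i j, mul_comm (d i)]
  have hcol : ∀ j, ∑ i, c i j = 0 := fun j => by
    rw [← hrow j]
    exact Finset.sum_congr rfl fun i _ => hcsymm i j
  have hcut : ∀ S : Finset (Fin n), ∑ i, ∑ j, c i j *
      |(S : Set (Fin n)).indicator 1 i - (S : Set (Fin n)).indicator (1 : Fin n → ℝ) j| =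
        2 * vol * Q S := by
    intro S
    have hneg : ∑ i ∈ S, ∑ j ∈ S, (A i j - d i * d j / vol) = -∑ i ∈ S, ∑ j ∈ S, c i j := by
      simp only [hc, ← Finset.sum_neg_distrib, neg_sub]
    rw [sum_mul_abs_indicator_sub c hrow hcol, hQ, hneg]
    field_simp
  apply le_antisymm
  · have h := sum_mul_abs_sub_le_of_indicator c (2 * vol * Q Sstar) (-a) b (by linarith)
      (fun S => (hcut S).trans_le
        (mul_le_mul_of_nonneg_left (hSstar_max S) (by positivity))) xstar hxstar_feas
    rw [hTVQ]
    linarith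
  · set g : Fin n → ℝ := (Sstar : Set (Fin n)).indicator 1 with hg
    have hfeas : ∀ i, -a ≤ (a + b) * g i - a ∧ (a + b) * g i - a ≤ b := by
      intro i
      by_cases hi : i ∈ Sstar <;> simp [hg, hi] <;> linarith
    refine le_of_eq_of_le ?_ (hxstar_max _ hfeas)
    have habs : ∀ i j, c i j * |(a + b) * g i - a - ((a + b) * g j - a)| =
        (a + b) * (c i j * |g i - g j|) := by
      intro i j
      rw [sub_sub_sub_cancel_right, ← mul_sub, abs_mul, abs_of_pos (add_pos ha hb)]
      ring
    change _ = TVQ fun i => (a + b) * g i - a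
    rw [hTVQ]
    change _ = 1 / 2 * ∑ i, ∑ j, c i j * |(a + b) * g i - a - ((a + b) * g j - a)|
    simp only [habs, ← Finset.mul_sum]
    rw [hcut]
    ring
end

section
/- Let a, b > 0 and let u ∈ ℝⁿ satisfy −a ≤ u_i ≤ b for all i. Then TV_Q(u) ≤ vol G · (a + b) · max_{S ⊆ V} Q(S). -/
open MeasureTheory in
/-- Layer-cake formula for a real number in `[0, c]`. -/
lemma setIntegral_indicator_Iic_eq {c m : ℝ} (hm0 : 0 ≤ m) (hmc : m ≤ c) :
    ∫ t in Set.Ioc 0 c, (Set.Iic m).indicator (fun _ => (1 : ℝ)) t = m := by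
  have hset : Set.Ioc 0 c ∩ Set.Iic m = Set.Ioc 0 m := by
    ext t
    simp only [Set.mem_inter_iff, Set.mem_Ioc, Set.mem_Iic]
    constructor
    · rintro ⟨⟨h0, -⟩, h⟩
      exact ⟨h0, h⟩
    · rintro ⟨h0, h⟩
      exact ⟨⟨h0, h.trans hmc⟩, h⟩
  rw [setIntegral_indicator measurableSet_Iic, hset]
  simp [hm0]

open MeasureTheory in
/-- If every principal block sum of `M` is at most `B`, then the pairing of `M` with the min-kernel
of a vector in `[0, c]ⁿ` is at most `c * B`. -/
lemma sum_mul_min_le_of_forall_block_sum_le {ι : Type*} [Fintype ι] (M : ι → ι → ℝ) {B c : ℝ}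
    (hB : ∀ S : Finset ι, ∑ i ∈ S, ∑ j ∈ S, M i j ≤ B) (hc : 0 ≤ c)
    (v : ι → ℝ) (hv0 : ∀ i, 0 ≤ v i) (hvc : ∀ i, v i ≤ c) :
    ∑ i, ∑ j, M i j * min (v i) (v j) ≤ c * B := by
  classical
  have hint : ∀ i j, Integrable
      (fun t => M i j * (Set.Iic (min (v i) (v j))).indicator (fun _ => (1 : ℝ)) t)
      (volume.restrict (Set.Ioc 0 c)) := fun i j =>
    ((integrable_const (1 : ℝ)).indicator measurableSet_Iic).const_mul _
  have hrepr : ∑ i, ∑ j, M i j * min (v i) (v j) = ∫ t in Set.Ioc 0 c,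
      ∑ i, ∑ j, M i j * (Set.Iic (min (v i) (v j))).indicator (fun _ => (1 : ℝ)) t := by
    rw [integral_finsetSum _ fun i _ => integrable_finsetSum _ fun j _ => hint i j]
    refine Finset.sum_congr rfl fun i _ => ?_
    rw [integral_finsetSum _ fun j _ => hint i j]
    refine Finset.sum_congr rfl fun j _ => ?_
    rw [integral_const_mul, setIntegral_indicator_Iic_eq (le_min (hv0 i) (hv0 j))
      ((min_le_left _ _).trans (hvc i))]
  have hlevel : ∀ t : ℝ,
      ∑ i, ∑ j, M i j * (Set.Iic (min (v i) (v j))).indicator (fun _ => (1 : ℝ)) t ≤ B := by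
    intro t
    refine le_trans (le_of_eq ?_) (hB (Finset.univ.filter fun i => t ≤ v i))
    rw [Finset.sum_filter]
    refine Finset.sum_congr rfl fun i _ => ?_
    rw [Finset.sum_filter]
    by_cases hi : t ≤ v i
    · simp [Set.indicator_apply, hi]
    · simp [hi]
  rw [hrepr]
  calc _ ≤ ∫ _ in Set.Ioc 0 c, B := integral_mono
        (integrable_finsetSum _ fun i _ => integrable_finsetSum _ fun j _ => hint i j)
        (integrable_const B) hlevel
    _ = c * B := by simp [hc]

/-- For a symmetric kernel with zero row sums, the total variation of `y` is the pairing with the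
min-kernel of any translate of `y`. -/
lemma half_sum_neg_mul_abs_sub_eq_sum_mul_min {ι : Type*} [Fintype ι] (M : ι → ι → ℝ)
    (hsym : ∀ i j, M i j = M j i) (hrow : ∀ i, ∑ j, M i j = 0) (y : ι → ℝ) (a : ℝ) :
    (1 / 2) * ∑ i, ∑ j, -M i j * |y i - y j| =
      ∑ i, ∑ j, M i j * min (y i + a) (y j + a) := by
  have hleft : ∑ i, ∑ j, M i j * (y i + a) = 0 := by
    simp [← Finset.sum_mul, hrow]
  have hright : ∑ i, ∑ j, M i j * (y j + a) = 0 := by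
    rw [Finset.sum_comm, ← hleft]
    exact Finset.sum_congr rfl fun i _ => Finset.sum_congr rfl fun j _ => by rw [hsym]
  have hsplit : ∑ i, ∑ j, -M i j * |y i - y j| =
      2 * ∑ i, ∑ j, M i j * min (y i + a) (y j + a) -
        ∑ i, ∑ j, M i j * (y i + a) - ∑ i, ∑ j, M i j * (y j + a) := by
    simp only [Finset.mul_sum, ← Finset.sum_sub_distrib]
    refine Finset.sum_congr rfl fun i _ => Finset.sum_congr rfl fun j _ => ?_
    rcases le_total (y i) (y j) with h | h
    · rw [abs_of_nonpos (by linarith), min_eq_left (by linarith)]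
      ring
    · rw [abs_of_nonneg (by linarith), min_eq_right (by linarith)]
      ring
  rw [hsplit, hleft, hright]
  ring

/-- Let `a, b > 0` and let `u ∈ ℝⁿ` satisfy `−a ≤ u_i ≤ b` for all `i`.
Then `TV_Q(u) ≤ vol G · (a + b) · max_{S ⊆ V} Q(S)`. -/
theorem tvQ_le_box_bound (n : ℕ) (A : Fin n → Fin n → ℝ)
    (hsym : ∀ i j, A i j = A j i) (hnn : ∀ i j, 0 ≤ A i j)
    (d : Fin n → ℝ) (hd : ∀ i, d i = ∑ j, A i j)
    (vol : ℝ) (hvol : vol = ∑ i, d i) (hvolpos : 0 < vol)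
    (Q : Finset (Fin n) → ℝ)
    (hQ : ∀ S : Finset (Fin n),
      Q S = (1 / vol) * ∑ i ∈ S, ∑ j ∈ S, (A i j - d i * d j / vol))
    (TVQ : (Fin n → ℝ) → ℝ)
    (hTVQ : ∀ y : Fin n → ℝ,
      TVQ y = (1 / 2) * ∑ i, ∑ j, (d i * d j / vol - A i j) * |y i - y j|)
    (a b : ℝ) (ha : 0 < a) (hb : 0 < b)
    (u : Fin n → ℝ) (hu : ∀ i, -a ≤ u i ∧ u i ≤ b)
    (Sstar : Finset (Fin n))
    (hSstar_max : ∀ S : Finset (Fin n), Q S ≤ Q Sstar) :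
    TVQ u ≤ vol * (a + b) * Q Sstar := by
  set M : Fin n → Fin n → ℝ := fun i j => A i j - d i * d j / vol with hM
  have hMsym : ∀ i j, M i j = M j i := fun i j => by
    simp only [hM]
    rw [hsym i j, mul_comm (d i)]
  have hMrow : ∀ i, ∑ j, M i j = 0 := fun i => by
    simp only [hM]
    rw [Finset.sum_sub_distrib, ← hd, ← Finset.sum_div, ← Finset.mul_sum, ← hvol,
      mul_div_cancel_right₀ _ hvolpos.ne', sub_self]
  have hblock : ∀ S : Finset (Fin n), ∑ i ∈ S, ∑ j ∈ S, M i j = vol * Q S := fun S => by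
    rw [hQ, ← mul_assoc, mul_one_div_cancel hvolpos.ne', one_mul]
  have hTV : TVQ u = ∑ i, ∑ j, M i j * min (u i + a) (u j + a) := by
    rw [hTVQ, ← half_sum_neg_mul_abs_sub_eq_sum_mul_min M hMsym hMrow u a]
    simp only [hM, neg_sub]
  rw [hTV]
  calc _ ≤ (a + b) * (vol * Q Sstar) :=
        sum_mul_min_le_of_forall_block_sum_le M
          (fun S => (hblock S).trans_le (mul_le_mul_of_nonneg_left (hSstar_max S) hvolpos.le))
          (by linarith) (fun i => u i + a) (fun i => by linarith [(hu i).1])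
          (fun i => by linarith [(hu i).2])
    _ = vol * (a + b) * Q Sstar := by ring
end

section
/- Let a, b > 0, suppose max_{S ⊆ V} Q(S) > 0, and let x* be a maximizer of TV_Q over the box B(a,b) = {x ∈ ℝⁿ : −a ≤ x_i ≤ b for all i}. Then x* lies on the boundary of B(a,b); that is, there exists an index i with x*_i = −a or x*_i = b. -/
/-- If all row and column sums of `M` vanish, the total variation of an indicator function weighted by `-M` is twice the sum of `M` over the indicated block. -/
theorem sum_neg_mul_abs_indicator_sub {ι : Type*} [Fintype ι] [DecidableEq ι]
    (M : ι → ι → ℝ) (hrow : ∀ i, ∑ j, M i j = 0) (hcol : ∀ j, ∑ i, M i j = 0) (S : Finset ι) :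
    ∑ i, ∑ j, -M i j * |(if i ∈ S then (1 : ℝ) else 0) - (if j ∈ S then 1 else 0)| =
      2 * ∑ i ∈ S, ∑ j ∈ S, M i j := by
  have habs : ∀ i j, -M i j * |(if i ∈ S then (1 : ℝ) else 0) - (if j ∈ S then 1 else 0)| =
      2 * (if i ∈ S then (if j ∈ S then M i j else 0) else 0)
        - (if i ∈ S then 1 else 0) * M i j - (if j ∈ S then 1 else 0) * M i j := by
    intro i j
    by_cases hi : i ∈ S <;> by_cases hj : j ∈ S <;> simp [hi, hj]; ring
  have hblock : ∑ i, ∑ j, (if i ∈ S then (if j ∈ S then M i j else 0) else 0) =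
      ∑ i ∈ S, ∑ j ∈ S, M i j := by
    rw [← Finset.sum_subset (Finset.subset_univ S) (fun i _ hi => by simp [hi])]
    refine Finset.sum_congr rfl fun i hi => ?_
    simp [hi]
  have h₁ : ∑ i, ∑ j, (if i ∈ S then (1 : ℝ) else 0) * M i j = 0 := by
    simp only [← Finset.mul_sum, hrow, mul_zero, Finset.sum_const_zero]
  have h₂ : ∑ i, ∑ j, (if j ∈ S then (1 : ℝ) else 0) * M i j = 0 := by
    rw [Finset.sum_comm]
    simp only [← Finset.mul_sum, hcol, mul_zero, Finset.sum_const_zero]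
  simp only [habs, Finset.sum_sub_distrib, ← Finset.mul_sum] at h₁ h₂ ⊢
  linarith


/-- Let `a, b > 0`, suppose `max_{S ⊆ V} Q(S) > 0`, and let `x*` be a
maximizer of `TV_Q` over the box `B(a,b) = {x ∈ ℝⁿ : −a ≤ x_i ≤ b ∀ i}`. Then `x*` lies
on the boundary of `B(a,b)`: there exists an index `i` with `x*_i = −a` or `x*_i = b`. -/
theorem tvQ_maximizer_on_boundary (n : ℕ) (A : Fin n → Fin n → ℝ)
    (hsym : ∀ i j, A i j = A j i) (hnn : ∀ i j, 0 ≤ A i j)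
    (d : Fin n → ℝ) (hd : ∀ i, d i = ∑ j, A i j)
    (vol : ℝ) (hvol : vol = ∑ i, d i) (hvolpos : 0 < vol)
    (Q : Finset (Fin n) → ℝ)
    (hQ : ∀ S : Finset (Fin n),
      Q S = (1 / vol) * ∑ i ∈ S, ∑ j ∈ S, (A i j - d i * d j / vol))
    (TVQ : (Fin n → ℝ) → ℝ)
    (hTVQ : ∀ y : Fin n → ℝ,
      TVQ y = (1 / 2) * ∑ i, ∑ j, (d i * d j / vol - A i j) * |y i - y j|)
    (a b : ℝ) (ha : 0 < a) (hb : 0 < b)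
    (hQpos : ∃ S : Finset (Fin n), 0 < Q S)
    (xstar : Fin n → ℝ)
    (hxstar_feas : ∀ i, -a ≤ xstar i ∧ xstar i ≤ b)
    (hxstar_max : ∀ x : Fin n → ℝ, (∀ i, -a ≤ x i ∧ x i ≤ b) → TVQ x ≤ TVQ xstar) :
    ∃ i : Fin n, xstar i = -a ∨ xstar i = b := by
  have hscale : ∀ (c : ℝ) (y : Fin n → ℝ), 0 ≤ c → TVQ (fun i => c * y i) = c * TVQ y := by
    intro c y hc
    have habs : ∀ i j, |c * y i - c * y j| = c * |y i - y j| := fun i j => by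
      rw [← mul_sub, abs_mul, abs_of_nonneg hc]
    simp only [hTVQ, habs, Finset.mul_sum]
    exact Finset.sum_congr rfl fun i _ => Finset.sum_congr rfl fun j _ => by ring
  have hrow : ∀ i, ∑ j, (A i j - d i * d j / vol) = 0 := by
    intro i
    rw [Finset.sum_sub_distrib, ← hd i, ← Finset.sum_div, ← Finset.mul_sum, ← hvol,
      mul_div_cancel_right₀ _ hvolpos.ne', sub_self]
  have hcol : ∀ j, ∑ i, (A i j - d i * d j / vol) = 0 := by
    intro j
    rw [← hrow j]
    exact Finset.sum_congr rfl fun i _ => by rw [hsym i j, mul_comm (d i)]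
  obtain ⟨S, hS⟩ := hQpos
  have hind : 0 < TVQ (fun i => if i ∈ S then 1 else 0) := by
    have h := sum_neg_mul_abs_indicator_sub (fun i j => A i j - d i * d j / vol) hrow hcol S
    simp only [neg_sub] at h
    rw [hQ S] at hS
    have := pos_of_mul_pos_right hS (by positivity)
    rw [hTVQ, h]
    linarith
  have hpos : 0 < TVQ xstar := by
    refine lt_of_lt_of_le (mul_pos hb hind) ?_
    rw [← hscale b _ hb.le]
    refine hxstar_max _ fun i => ?_
    by_cases hi : i ∈ S <;> simp only [hi, if_true, if_false] <;> constructor <;> linarith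
  by_contra! hint
  have hnear : ∀ᶠ c : ℝ in nhds 1, ∀ i, -a ≤ c * xstar i ∧ c * xstar i ≤ b := by
    refine Filter.eventually_all.2 fun i => ?_
    have ht : Filter.Tendsto (fun c : ℝ => c * xstar i) (nhds 1) (nhds (xstar i)) := by
      simpa using (continuous_mul_const (xstar i)).tendsto (1 : ℝ)
    exact ht.eventually (Icc_mem_nhds
      (lt_of_le_of_ne (hxstar_feas i).1 (hint i).1.symm)
      (lt_of_le_of_ne (hxstar_feas i).2 (hint i).2))
  obtain ⟨c, hc, hc1⟩ :=
    ((hnear.filter_mono nhdsWithin_le_nhds).and (self_mem_nhdsWithin (s := Set.Ioi (1 : ℝ)))).exists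
  have hc1 : 1 < c := hc1
  have hle := hxstar_max _ hc
  rw [hscale c _ (by linarith)] at hle
  nlinarith
end

section
/- Let f : ℝⁿ → ℝ be continuously differentiable, l, u ∈ ℝⁿ with l < u componentwise, and let x* be a stationary point of the problem min f(x) subject to l ≤ x ≤ u. Then there exists ρ > 0 such that for every x with ‖x − x*‖ ≤ ρ: (i) A_l(x) ⊆ {i : x*_i = l_i} and A_u(x) ⊆ {i : x*_i = u_i}; and (ii) for every index i with x*_i = l_i and ∇_i f(x*) > 0, if x_i = l_i then i ∈ A_l(x), and for every index i with x*_i = u_i and ∇_i f(x*) < 0, if x_i = u_i then i ∈ A_u(x). -/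
/-- Let `f : ℝⁿ → ℝ` be continuously differentiable, `l < u`
componentwise, and let `x*` be a stationary point of `min f(x) s.t. l ≤ x ≤ u`. Then
there exists `ρ > 0` such that for every `x` with `‖x − x*‖ ≤ ρ`:
(i) `A_l(x) ⊆ {i : x*_i = l_i}` and `A_u(x) ⊆ {i : x*_i = u_i}`; and
(ii) for every `i` with `x*_i = l_i` and `∇_i f(x*) > 0`, if `x_i = l_i` then
`i ∈ A_l(x)`, and for every `i` with `x*_i = u_i` and `∇_i f(x*) < 0`, if `x_i = u_i`
then `i ∈ A_u(x)`. Here `A_l(x) = {i : x_i = l_i, ∇_i f(x) > 0}` and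
`A_u(x) = {i : x_i = u_i, ∇_i f(x) < 0}`. -/
theorem active_set_estimate (n : ℕ)
    (f : (Fin n → ℝ) → ℝ) (hf : ContDiff ℝ 1 f)
    (l u : Fin n → ℝ) (hlu : ∀ i, l i < u i)
    (g : (Fin n → ℝ) → (Fin n → ℝ))
    (hg : ∀ x i, g x i = fderiv ℝ f x (Pi.single i 1))
    (xstar : Fin n → ℝ) (hfeas : ∀ i, l i ≤ xstar i ∧ xstar i ≤ u i)
    (hstat : ∀ i, (l i < xstar i → xstar i < u i → g xstar i = 0) ∧
      (xstar i = l i → 0 ≤ g xstar i) ∧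
      (xstar i = u i → g xstar i ≤ 0)) :
    ∃ ρ > (0 : ℝ), ∀ x : Fin n → ℝ, ‖x - xstar‖ ≤ ρ →
      (∀ i, x i = l i ∧ 0 < g x i → xstar i = l i) ∧
      (∀ i, x i = u i ∧ g x i < 0 → xstar i = u i) ∧
      (∀ i, xstar i = l i → 0 < g xstar i → x i = l i → x i = l i ∧ 0 < g x i) ∧
      (∀ i, xstar i = u i → g xstar i < 0 → x i = u i → x i = u i ∧ g x i < 0) := by
  have hgc : ∀ i, Continuous fun x => g x i := fun i => by
    simp only [hg]
    exact (hf.continuous_fderiv one_ne_zero).clm_apply continuous_const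
  have hev : ∀ᶠ x in nhds xstar, ∀ i,
      (xstar i ≠ l i → x i ≠ l i) ∧ (xstar i ≠ u i → x i ≠ u i) ∧
      (0 < g xstar i → 0 < g x i) ∧ (g xstar i < 0 → g x i < 0) := by
    refine Filter.eventually_all.2 fun i => ?_
    have hxi := (continuous_apply i).continuousAt (x := xstar)
    have hgi := (hgc i).continuousAt (x := xstar)
    simp only [Filter.eventually_and, Filter.eventually_imp_distrib_left]
    exact ⟨hxi.eventually_ne, hxi.eventually_ne, hgi.eventually_const_lt,
      hgi.eventually_lt_const⟩
  obtain ⟨ρ, hρ, h⟩ := Metric.nhds_basis_closedBall.eventually_iff.1 hev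
  refine ⟨ρ, hρ, fun x hx => ?_⟩
  have hx' := h (mem_closedBall_iff_norm.2 hx)
  refine ⟨fun i hi => ?_, fun i hi => ?_, fun i _ hgi hxi => ⟨hxi, (hx' i).2.2.1 hgi⟩,
    fun i _ hgi hxi => ⟨hxi, (hx' i).2.2.2 hgi⟩⟩
  · exact not_imp_not.1 (hx' i).1 hi.1
  · exact not_imp_not.1 (hx' i).2.1 hi.1
end
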